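/- arXiv:1709.02343 — 2 statements merged into one kernel-verified Lean document; each statement's English description precedes it below -/
import Mathlib

section
/- Let V be a type with a distance d : V → V → ℝ that is nonnegative, vanishes on the diagonal, and satisfies the triangle inequality, and let d_r(u,v) = d(u,v) + d(v,u). Let T ⊆ V be finite and nonempty and define D(T,s) = min_{u,w ∈ T} ( d(u,s) + d(s,w) − d(u,w) ). Then for all sites s, s' ∈ V, D(T,s) ≤ D(T,s') + d_r(s',s); that is, the trajectory inconvenience function s ↦ D(T,s) is 1-Lipschitz with respect to the round-trip distance between sites (a user can always detour to s' and make a side round trip from s' to s). -/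
/-- The round-trip distance `d_r(u,v) = d(u,v) + d(v,u)`. -/
def roundTrip {V : Type*} (d : V → V → ℝ) (u v : V) : ℝ := d u v + d v u

/-- The inconvenience (extra distance traveled) of a trajectory `T` (a finite
nonempty set of nodes) to reach a site `s`. -/
noncomputable def detour {V : Type*} (d : V → V → ℝ) (T : Finset V)
    (hT : T.Nonempty) (s : V) : ℝ :=
  (T ×ˢ T).inf' (hT.product hT) (fun p => d p.1 s + d s p.2 - d p.1 p.2)

theorem detour_lipschitz {V : Type*} (d : V → V → ℝ)
    (hdiag : ∀ v, d v v = 0)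
    (hnonneg : ∀ u v, 0 ≤ d u v)
    (htri : ∀ u v w, d u w ≤ d u v + d v w)
    (T : Finset V) (hT : T.Nonempty) (s s' : V) :
    detour d T hT s ≤ detour d T hT s' + roundTrip d s' s := by
  obtain ⟨p, hp, hmin⟩ := (T ×ˢ T).exists_mem_eq_inf' (hT.product hT)
    (fun p => d p.1 s' + d s' p.2 - d p.1 p.2)
  have hle : detour d T hT s ≤ d p.1 s + d s p.2 - d p.1 p.2 := Finset.inf'_le _ hp
  have hto := htri p.1 s' s
  have hback := htri s s' p.2
  unfold detour roundTrip at *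
  rw [hmin]
  linarith
end

section
/- Let 𝒯 be a finite index set of trajectories, S a finite nonempty type of sites, c : 𝒯 → S → ℝ a cost function, and F a fixed finite nonempty set of existing facilities. Define TI(Q) = Σ_{j ∈ 𝒯} min_{s ∈ Q ∪ F} c(j,s) and f(Q) = TI(∅) − TI(Q). Fix k ≥ 1 and a finite set Q of sites, and let s* ∈ S achieve the maximum marginal gain, i.e. f(Q ∪ {s*}) ≥ f(Q ∪ {s}) for all s ∈ S. Then for every set A of sites with |A| ≤ k, f(A) − f(Q ∪ {s*}) ≤ (1 − 1/k) · ( f(A) − f(Q) ); i.e., each greedy step shrinks the gap to any k-element target by a factor of at least (1 − 1/k). -/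
/-- Total inconvenience of all trajectories `𝒯` when the new sites `Q` are
added to the existing facilities `F`: each trajectory `j` is served by its
nearest facility in `Q ∪ F`, at cost `c j s`. -/
noncomputable def totalInc {J S : Type*} [DecidableEq S] (𝒯 : Finset J)
    (c : J → S → ℝ) (F : Finset S) (hF : F.Nonempty) (Q : Finset S) : ℝ :=
  ∑ j ∈ 𝒯, (Q ∪ F).inf' (hF.mono Finset.subset_union_right) (c j)

/-- The saving function `f(Q) = TI(∅) − TI(Q)`. -/
noncomputable def saving {J S : Type*} [DecidableEq S] (𝒯 : Finset J)
    (c : J → S → ℝ) (F : Finset S) (hF : F.Nonempty) (Q : Finset S) : ℝ :=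
  totalInc 𝒯 c F hF ∅ - totalInc 𝒯 c F hF Q

/-- Adding sites never increases the total inconvenience. -/
lemma totalInc_anti {J S : Type*} [DecidableEq S] (𝒯 : Finset J) (c : J → S → ℝ)
    (F : Finset S) (hF : F.Nonempty) {P Q : Finset S} (h : P ⊆ Q) :
    totalInc 𝒯 c F hF Q ≤ totalInc 𝒯 c F hF P :=
  Finset.sum_le_sum fun j _ =>
    Finset.inf'_mono (c j) (Finset.union_subset_union_left h)
      (hF.mono Finset.subset_union_right)

/-- The saving function is monotone. -/
lemma saving_mono {J S : Type*} [DecidableEq S] (𝒯 : Finset J) (c : J → S → ℝ)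
    (F : Finset S) (hF : F.Nonempty) {P Q : Finset S} (h : P ⊆ Q) :
    saving 𝒯 c F hF P ≤ saving 𝒯 c F hF Q :=
  sub_le_sub_left (totalInc_anti 𝒯 c F hF h) _

/-- The gain of moving from `Q` to `A` is at most the sum of the marginal gains at `Q` of the
elements of `A`. -/
lemma saving_sub_le_sum_marginal {J S : Type*} [DecidableEq S] (𝒯 : Finset J) (c : J → S → ℝ)
    (F : Finset S) (hF : F.Nonempty) (A Q : Finset S) :
    saving 𝒯 c F hF A - saving 𝒯 c F hF Q ≤
      ∑ s ∈ A, (saving 𝒯 c F hF (Q ∪ {s}) - saving 𝒯 c F hF Q) := by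
  simp only [saving, totalInc, sub_sub_sub_cancel_left, ← Finset.sum_sub_distrib]
  rw [Finset.sum_comm]
  refine Finset.sum_le_sum fun j _ => ?_
  have hnonneg : ∀ s ∈ A, 0 ≤ (Q ∪ F).inf' (hF.mono Finset.subset_union_right) (c j) -
      (Q ∪ {s} ∪ F).inf' (hF.mono Finset.subset_union_right) (c j) := fun s _ =>
    sub_nonneg.2 <| Finset.inf'_mono (c j)
      (Finset.union_subset_union_left Finset.subset_union_left)
      (hF.mono Finset.subset_union_right)
  obtain ⟨t, ht, hmin⟩ :=
    (A ∪ F).exists_mem_eq_inf' (hF.mono Finset.subset_union_right) (c j)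
  rw [hmin]
  rcases Finset.mem_union.1 ht with htA | htF
  · refine le_trans (sub_le_sub_left ?_ _) (Finset.single_le_sum hnonneg htA)
    exact Finset.inf'_le _ (by simp)
  · exact (sub_nonpos.2 (Finset.inf'_le _ (Finset.mem_union_right Q htF))).trans
      (Finset.sum_nonneg hnonneg)

theorem greedy_step_gap_shrinks {J S : Type*} [Fintype S] [Nonempty S] [DecidableEq S]
    (𝒯 : Finset J) (c : J → S → ℝ) (F : Finset S) (hF : F.Nonempty)
    (k : ℕ) (hk : 1 ≤ k) (Q : Finset S) (sstar : S)
    (hstar : ∀ s : S, saving 𝒯 c F hF (Q ∪ {s}) ≤ saving 𝒯 c F hF (Q ∪ {sstar}))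
    (A : Finset S) (hA : A.card ≤ k) :
    saving 𝒯 c F hF A - saving 𝒯 c F hF (Q ∪ {sstar}) ≤
      (1 - 1 / (k : ℝ)) * (saving 𝒯 c F hF A - saving 𝒯 c F hF Q) := by
  have hgain : 0 ≤ saving 𝒯 c F hF (Q ∪ {sstar}) - saving 𝒯 c F hF Q :=
    sub_nonneg.2 (saving_mono 𝒯 c F hF Finset.subset_union_left)
  have hgap : saving 𝒯 c F hF A - saving 𝒯 c F hF Q ≤
      k * (saving 𝒯 c F hF (Q ∪ {sstar}) - saving 𝒯 c F hF Q) := by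
    calc
      _ ≤ ∑ s ∈ A, (saving 𝒯 c F hF (Q ∪ {s}) - saving 𝒯 c F hF Q) :=
        saving_sub_le_sum_marginal 𝒯 c F hF A Q
      _ ≤ A.card * (saving 𝒯 c F hF (Q ∪ {sstar}) - saving 𝒯 c F hF Q) := by
        rw [← nsmul_eq_mul]
        exact Finset.sum_le_card_nsmul _ _ _ fun s _ => sub_le_sub_right (hstar s) _
      _ ≤ _ := by gcongr
  have hk' : (0 : ℝ) < k := by exact_mod_cast hk
  have hdiv := (div_le_iff₀' hk').2 hgap
  rw [sub_mul, one_mul, one_div_mul_eq_div]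
  linarith
end
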